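/- Let μ : ℂ^n → ℝ be defined by μ(v₁, v₂) = -|v₁|² + |v₂|², where v₁ ∈ ℂ^{k₁}, v₂ ∈ ℂ^{k₂}, n = k₁ + k₂. For any r > 0 there exists δ > 0 such that for every ε with 0 < ε < δ, there is a smooth function μ' : ℂ^n → ℝ satisfying: (1) the critical set of μ' is exactly {0}; (2) μ'(0) = ε; (3) μ' = μ + ε on some neighborhood of 0; (4) μ' = μ outside the closed ball of radius √r around 0. -/

import Mathlib

/-- The standard momentum map `μ(v₁, v₂) = -|v₁|² + |v₂|²` on `ℂ^{k₁} × ℂ^{k₂}`. -/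
noncomputable def muStd (k₁ k₂ : ℕ) :
    EuclideanSpace ℂ (Fin k₁) × EuclideanSpace ℂ (Fin k₂) → ℝ :=
  fun v => -‖v.1‖ ^ 2 + ‖v.2‖ ^ 2

section PerturbedQuadratic

variable {E F : Type*} [NormedAddCommGroup E] [InnerProductSpace ℝ E]
  [NormedAddCommGroup F] [InnerProductSpace ℝ F]

/-- The function `-|x|² + |y|² + ε ρ(|x|² + |y|²)` on `E × F`. -/
noncomputable def perturbedQuadratic (ε : ℝ) (ρ : ℝ → ℝ) (v : E × F) : ℝ :=
  -‖v.1‖ ^ 2 + ‖v.2‖ ^ 2 + ε * ρ (‖v.1‖ ^ 2 + ‖v.2‖ ^ 2)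

theorem contDiff_perturbedQuadratic {n : ℕ∞} {ε : ℝ} {ρ : ℝ → ℝ} (hρ : ContDiff ℝ n ρ) :
    ContDiff ℝ n (perturbedQuadratic ε ρ : E × F → ℝ) := by
  have h₁ : ContDiff ℝ n fun v : E × F => ‖v.1‖ ^ 2 := contDiff_fst.norm_sq ℝ
  have h₂ : ContDiff ℝ n fun v : E × F => ‖v.2‖ ^ 2 := contDiff_snd.norm_sq ℝ
  exact (h₁.neg.add h₂).add (contDiff_const.mul (hρ.comp (h₁.add h₂)))

theorem fderiv_perturbedQuadratic_apply {ε : ℝ} {ρ : ℝ → ℝ} (hρ : Differentiable ℝ ρ)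
    (v w : E × F) :
    fderiv ℝ (perturbedQuadratic ε ρ) v w =
      -2 * (1 - ε * deriv ρ (‖v.1‖ ^ 2 + ‖v.2‖ ^ 2)) * inner ℝ v.1 w.1 +
        2 * (1 + ε * deriv ρ (‖v.1‖ ^ 2 + ‖v.2‖ ^ 2)) * inner ℝ v.2 w.2 := by
  have h₁ := (hasFDerivAt_fst (𝕜 := ℝ) (p := v)).norm_sq
  have h₂ := (hasFDerivAt_snd (𝕜 := ℝ) (p := v)).norm_sq
  have h := (h₁.neg.add h₂).add
    (((hρ (‖v.1‖ ^ 2 + ‖v.2‖ ^ 2)).hasDerivAt.comp_hasFDerivAt v (h₁.add h₂)).const_mul ε)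
  have h' : HasFDerivAt (perturbedQuadratic ε ρ) _ v := h
  rw [h'.fderiv]
  simp
  ring

theorem fderiv_perturbedQuadratic_eq_zero_iff {ε : ℝ} {ρ : ℝ → ℝ} (hρ : Differentiable ℝ ρ)
    (hε : ∀ t, |ε * deriv ρ t| < 1) (v : E × F) :
    fderiv ℝ (perturbedQuadratic ε ρ) v = 0 ↔ v = 0 := by
  constructor
  · intro h
    obtain ⟨hlo, hhi⟩ := abs_lt.1 (hε (‖v.1‖ ^ 2 + ‖v.2‖ ^ 2))
    have h₁ := fderiv_perturbedQuadratic_apply (ε := ε) hρ v (v.1, 0)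
    have h₂ := fderiv_perturbedQuadratic_apply (ε := ε) hρ v (0, v.2)
    rw [h] at h₁ h₂
    have n₁ : 1 - ε * deriv ρ (‖v.1‖ ^ 2 + ‖v.2‖ ^ 2) ≠ 0 := by linarith
    have n₂ : 1 + ε * deriv ρ (‖v.1‖ ^ 2 + ‖v.2‖ ^ 2) ≠ 0 := by linarith
    simp [n₁] at h₁
    simp [n₂] at h₂
    exact Prod.ext h₁ h₂
  · rintro rfl
    ext w <;> simp [fderiv_perturbedQuadratic_apply hρ]

theorem exists_morse_perturbation {r : ℝ} (hr : 0 < r) :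
    ∃ δ > (0 : ℝ), ∀ ε : ℝ, 0 < ε → ε < δ →
      ∃ f : E × F → ℝ,
        ContDiff ℝ (⊤ : ℕ∞) f ∧
        (∀ v, fderiv ℝ f v = 0 ↔ v = 0) ∧
        f 0 = ε ∧
        (∀ᶠ v in nhds 0, f v = -‖v.1‖ ^ 2 + ‖v.2‖ ^ 2 + ε) ∧
        (∀ v : E × F, ‖v.1‖ ^ 2 + ‖v.2‖ ^ 2 > r → f v = -‖v.1‖ ^ 2 + ‖v.2‖ ^ 2) := by
  let ρ : ContDiffBump (0 : ℝ) := ⟨r / 2, r, half_pos hr, half_lt_self hr⟩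
  have hρ : ContDiff ℝ (⊤ : ℕ∞) ρ := ρ.contDiff
  have hsmall : ∀ t, |t| ≤ r / 2 → ρ t = 1 := fun t ht =>
    ρ.one_of_mem_closedBall (by simpa [ρ] using ht)
  obtain ⟨C, hC⟩ := (hρ.continuous_deriv (by simp)).bounded_above_of_compact_support
    ρ.hasCompactSupport.deriv
  have hC₀ : 0 ≤ C := (norm_nonneg _).trans (hC 0)
  refine ⟨1 / (C + 1), by positivity, fun ε hε hεδ => ⟨perturbedQuadratic ε ρ,
    contDiff_perturbedQuadratic hρ,
    fderiv_perturbedQuadratic_eq_zero_iff (hρ.differentiable (by simp)) fun t => ?_, ?_, ?_, ?_⟩⟩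
  · rw [lt_div_iff₀ (by positivity)] at hεδ
    have ht : ε * |deriv ρ t| ≤ ε * C := by
      gcongr
      exact hC t
    rw [abs_mul, abs_of_pos hε]
    linarith
  · simp [perturbedQuadratic, hsmall 0 (by simpa using (half_pos hr).le)]
  · have hc : Continuous fun v : E × F => |‖v.1‖ ^ 2 + ‖v.2‖ ^ 2| := by fun_prop
    filter_upwards [(hc.tendsto 0).eventually_lt_const (show _ < r / 2 by simpa using hr)]
      with v hv
    rw [perturbedQuadratic, hsmall _ hv.le, mul_one]
  · intro v hv
    have h₀ : ρ (‖v.1‖ ^ 2 + ‖v.2‖ ^ 2) = 0 := ρ.zero_of_le_dist <| by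
      rw [Real.dist_0_eq_abs]
      exact hv.le.trans (le_abs_self _)
    rw [perturbedQuadratic, h₀, mul_zero, add_zero]

end PerturbedQuadratic

/-- For any `r > 0` there is `δ > 0` such that for all `0 < ε < δ` there is a smooth
function `μ'` whose critical set is exactly `{0}`, with `μ'(0) = ε`, agreeing with `μ + ε`
near `0`, and agreeing with `μ` outside the closed ball of radius `√r`
(i.e. where `|v₁|² + |v₂|² > r`). -/
theorem stmt0 (k₁ k₂ : ℕ) (r : ℝ) (hr : 0 < r) :
    ∃ δ > (0 : ℝ), ∀ ε : ℝ, 0 < ε → ε < δ →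
      ∃ μ' : EuclideanSpace ℂ (Fin k₁) × EuclideanSpace ℂ (Fin k₂) → ℝ,
        ContDiff ℝ (⊤ : ℕ∞) μ' ∧
        (∀ v, fderiv ℝ μ' v = 0 ↔ v = 0) ∧
        μ' 0 = ε ∧
        (∀ᶠ v in nhds 0, μ' v = muStd k₁ k₂ v + ε) ∧
        (∀ v : EuclideanSpace ℂ (Fin k₁) × EuclideanSpace ℂ (Fin k₂),
          ‖v.1‖ ^ 2 + ‖v.2‖ ^ 2 > r → μ' v = muStd k₁ k₂ v) := by
  exact exists_morse_perturbation hr
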